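/- Let $G$ be a $6$-double-critical graph that is claw-free, and assume $G$ is not isomorphic to $K_6$. Then for every edge $xy \in E(G)$, the number of common neighbors satisfies $4 \le |N(x) \cap N(y)| \le 5$. -/

import Mathlib

open SimpleGraph

/-- A connected graph `G` with chromatic number `n` is `n`-double-critical if
deleting the two endpoints of any edge drops the chromatic number to `n - 2`. -/
def DoubleCritical {V : Type*} (G : SimpleGraph V) (n : ℕ) : Prop :=
  G.Connected ∧ G.chromaticNumber = (n : ℕ∞) ∧
    ∀ x y : V, G.Adj x y →
      (G.induce ({x, y}ᶜ : Set V)).chromaticNumber = ((n - 2 : ℕ) : ℕ∞)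

/-- A graph is claw-free if it has no induced `K_{1,3}`. -/
def ClawFree {V : Type*} (G : SimpleGraph V) : Prop :=
  ∀ v a b c : V, G.Adj v a → G.Adj v b → G.Adj v c →
    a ≠ b → a ≠ c → b ≠ c → ¬ G.Adj a b → ¬ G.Adj a c → ¬ G.Adj b c → False

namespace DoubleCritical

variable {V : Type*} {G : SimpleGraph V}

lemma exists_coloring_off_edge (h : DoubleCritical G 6) {x y : V} (hxy : G.Adj x y) :
    ∃ c : V → Fin 4, ∀ a b, a ≠ x → a ≠ y → b ≠ x → b ≠ y → G.Adj a b → c a ≠ c b := by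
  classical
  have h4 := h.2.2 x y hxy
  have hc : (G.induce ({x, y}ᶜ : Set V)).Colorable 4 :=
    chromaticNumber_le_iff_colorable.1 h4.le
  obtain ⟨c⟩ := hc
  refine ⟨fun a => if ha : a ∈ ({x, y}ᶜ : Set V) then c ⟨a, ha⟩ else 0, ?_⟩
  intro a b hax hay hbx hby hab
  have ha : a ∈ ({x, y}ᶜ : Set V) := by simp [hax, hay]
  have hb : b ∈ ({x, y}ᶜ : Set V) := by simp [hbx, hby]
  simp only [dif_pos ha, dif_pos hb]
  exact c.valid (v := ⟨a, ha⟩) (w := ⟨b, hb⟩) hab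

lemma exists_monochromatic_edge (h : DoubleCritical G 6) (c : V → Option (Fin 4)) :
    ∃ a b, G.Adj a b ∧ c a = c b := by
  by_contra! hc
  have h5 : G.Colorable 5 := (Coloring.mk c fun {a b} hab => hc a b hab).colorable
  have := chromaticNumber_le_iff_colorable.2 h5
  rw [h.2.1] at this
  norm_cast at this

lemma exists_commonNeighbor_color_eq (h : DoubleCritical G 6) {x y : V}
    {c : V → Fin 4}
    (hc : ∀ a b, a ≠ x → a ≠ y → b ≠ x → b ≠ y → G.Adj a b → c a ≠ c b) (i : Fin 4) :
    ∃ w, G.Adj x w ∧ G.Adj y w ∧ c w = i := by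
  classical
  by_contra! hi
  obtain ⟨a, b, hab, he⟩ := h.exists_monochromatic_edge fun v =>
    if v = x then none else if v = y then some i else
      if c v = i ∧ ¬ G.Adj x v then none else some (c v)
  have hba := hab.symm
  have hne := hab.ne
  have h1 := hc a b
  have h2 := hi a
  have h3 := hi b
  grind

lemma four_le_ncard_commonNeighbors [Finite V] (h : DoubleCritical G 6) {x y : V}
    (hxy : G.Adj x y) : 4 ≤ (G.neighborSet x ∩ G.neighborSet y).ncard := by
  obtain ⟨c, hc⟩ := h.exists_coloring_off_edge hxy
  choose f hfx hfy hfc using h.exists_commonNeighbor_color_eq hc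
  have hf : Function.Injective f := Function.LeftInverse.injective hfc
  calc 4 = (Set.range f).ncard := by
        rw [← Set.image_univ, Set.ncard_image_of_injective _ hf]; simp
    _ ≤ _ := Set.ncard_le_ncard (by rintro _ ⟨i, rfl⟩; exact ⟨hfx i, hfy i⟩) (Set.toFinite _)

lemma exists_adj_not_adj (h : DoubleCritical G 6) {x y : V} (hne : x ≠ y) : ∃ z, G.Adj y z ∧ ¬ G.Adj x z := by
  classical
  by_contra! hz
  have : Nontrivial V := ⟨x, y, hne⟩
  obtain ⟨w, hw⟩ := h.1.preconnected.exists_adj_of_nontrivial y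
  obtain ⟨c, hc⟩ := h.exists_coloring_off_edge hw
  obtain ⟨a, b, hab, he⟩ := h.exists_monochromatic_edge fun v =>
    if v = w then none else if v = y then some (c x) else some (c v)
  have hba := hab.symm
  have hn := hab.ne
  have hxw := hz w hw
  have := hxw.ne
  have h1 := hc a b
  have h2 := hc x a
  have h3 := hc x b
  have h4 := hz a
  have h5 := hz b
  grind

lemma exists_coloring_closedNeighborhood (h : DoubleCritical G 6) {x y : V} (hne : x ≠ y)
    (hxy : ¬ G.Adj x y) :
    ∃ c : V → Fin 4, (∀ a, G.Adj x a → c x ≠ c a) ∧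
      ∀ a b, G.Adj x a → G.Adj x b → G.Adj a b → c a ≠ c b := by
  obtain ⟨z, hyz, hxz⟩ := h.exists_adj_not_adj hne
  obtain ⟨c, hc⟩ := h.exists_coloring_off_edge hyz
  have key : ∀ a, G.Adj x a → a ≠ y ∧ a ≠ z := by
    intro a ha
    constructor <;> rintro rfl <;> contradiction
  have hz : x ≠ z := by
    rintro rfl
    exact hxy hyz.symm
  exact ⟨c, fun a ha => hc x a hne hz (key a ha).1 (key a ha).2 ha,
    fun a b ha hb => hc a b (key a ha).1 (key a ha).2 (key b hb).1 (key b hb).2⟩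

end DoubleCritical

namespace ClawFree

variable {V : Type*} {G : SimpleGraph V}

lemma ncard_color_neighbors_le_two [Finite V] (h : ClawFree G) {α : Type*} {x : V} {c : V → α}
    (hc : ∀ a b, G.Adj x a → G.Adj x b → G.Adj a b → c a ≠ c b) (i : α) :
    {w | G.Adj x w ∧ c w = i}.ncard ≤ 2 := by
  by_contra! h3
  obtain ⟨a, ha, b, hb, d, hd, hab, had, hbd⟩ := (Set.two_lt_ncard (Set.toFinite _)).1 h3
  exact h x a b d ha.1 hb.1 hd.1 hab had hbd
    (fun e => hc a b ha.1 hb.1 e (ha.2.trans hb.2.symm))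
    (fun e => hc a d ha.1 hd.1 e (ha.2.trans hd.2.symm))
    (fun e => hc b d hb.1 hd.1 e (hb.2.trans hd.2.symm))

lemma ncard_neighborSet_le_six [Finite V] (h : ClawFree G) (hG : DoubleCritical G 6) {x y : V}
    (hne : x ≠ y) (hxy : ¬ G.Adj x y) : (G.neighborSet x).ncard ≤ 6 := by
  classical
  have := Fintype.ofFinite V
  obtain ⟨c, hcx, hc⟩ := hG.exists_coloring_closedNeighborhood hne hxy
  rw [Set.ncard_eq_toFinset_card']
  have hmaps : ∀ a ∈ (G.neighborSet x).toFinset, c a ∈ Finset.univ.erase (c x) := by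
    intro a ha
    simpa using (hcx a (by simpa using ha)).symm
  have := Finset.card_le_mul_card_image_of_maps_to hmaps 2 (by
    intro i _
    refine le_trans (le_of_eq ?_) (h.ncard_color_neighbors_le_two hc i)
    rw [Set.ncard_eq_toFinset_card']
    congr 1
    ext a
    simp)
  simpa using this

lemma ncard_commonNeighbors_le_five [Finite V] (h : ClawFree G) (hG : DoubleCritical G 6)
    {x y z : V} (hxy : G.Adj x y) (hne : x ≠ z) (hxz : ¬ G.Adj x z) :
    (G.neighborSet x ∩ G.neighborSet y).ncard ≤ 5 := by
  have h6 := h.ncard_neighborSet_le_six hG hne hxz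
  have hlt : (G.neighborSet x ∩ G.neighborSet y).ncard < (G.neighborSet x).ncard :=
    Set.ncard_lt_ncard
      ⟨Set.inter_subset_left, fun hs => G.loopless.irrefl y (hs hxy).2⟩ (Set.toFinite _)
  omega

lemma eq_top_of_two_universal [Finite V] (h : ClawFree G) (hG : DoubleCritical G 6)
    {x y : V} (hxy : x ≠ y) (hx : ∀ z, x ≠ z → G.Adj x z) (hy : ∀ z, y ≠ z → G.Adj y z) :
    G = ⊤ := by
  by_contra htop
  obtain ⟨u, v, huv, hadj⟩ := G.ne_top_iff_exists_not_adj.1 htop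
  obtain ⟨c, hcu, hc⟩ := hG.exists_coloring_closedNeighborhood huv hadj
  have hxu : x ≠ u := by
    rintro rfl
    exact hadj (hx v huv)
  have hyu : y ≠ u := by
    rintro rfl
    exact hadj (hy v huv)
  have hux := (hx u hxu).symm
  have huy := (hy u hyu).symm
  obtain ⟨i, hi⟩ : ∃ i : Fin 4, ∀ j, j ≠ c u → j ≠ c x → j ≠ c y → j = i := by
    have hcard : ({c u, c x, c y}ᶜ : Finset (Fin 4)).card = 1 := by
      rw [Finset.card_compl, Finset.card_eq_three.2
        ⟨_, _, _, hcu x hux, hcu y huy, hc x y hux huy (hx y hxy), rfl⟩, Fintype.card_fin]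
    obtain ⟨i, hi⟩ := Finset.card_eq_one.1 hcard
    refine ⟨i, fun j h1 h2 h3 => ?_⟩
    have hj : j ∈ ({c u, c x, c y}ᶜ : Finset (Fin 4)) := by simp [h1, h2, h3]
    simpa [hi] using hj
  have hsub : G.neighborSet u ∩ G.neighborSet x ⊆ insert y {w | G.Adj u w ∧ c w = i} := by
    rintro w ⟨huw, hxw⟩
    rw [mem_neighborSet] at huw hxw
    by_cases hwy : w = y
    · exact Or.inl hwy
    · exact Or.inr ⟨huw, hi _ (hcu w huw).symm (hc x w hux huw hxw).symm
        (hc y w huy huw (hy w (Ne.symm hwy))).symm⟩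
  have h1 := hG.four_le_ncard_commonNeighbors hux
  have h2 := Set.ncard_le_ncard hsub (Set.toFinite _)
  have h3 := Set.ncard_insert_le y {w | G.Adj u w ∧ c w = i}
  have h4 := h.ncard_color_neighbors_le_two hc i
  omega

end ClawFree

/-- In a claw-free 6-double-critical graph not isomorphic to $K_6$,
any two adjacent vertices have between 4 and 5 common neighbors. -/
theorem stmt_5 {V : Type*} [Fintype V] (G : SimpleGraph V)
    (hdc : DoubleCritical G 6) (hcf : ClawFree G)
    (hniso : ¬ Nonempty (G ≃g (⊤ : SimpleGraph (Fin 6)))) :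
    ∀ x y : V, G.Adj x y →
      4 ≤ (G.neighborSet x ∩ G.neighborSet y).ncard ∧
        (G.neighborSet x ∩ G.neighborSet y).ncard ≤ 5 := by
  intro x y hxy
  refine ⟨hdc.four_le_ncard_commonNeighbors hxy, ?_⟩
  by_cases hx : ∀ z, x ≠ z → G.Adj x z
  · by_cases hy : ∀ z, y ≠ z → G.Adj y z
    · have htop := hcf.eq_top_of_two_universal hdc hxy.ne hx hy
      subst htop
      have hcard : Fintype.card V = 6 := by
        have := hdc.2.1
        rw [chromaticNumber_top] at this
        exact_mod_cast this
      exact absurd ⟨Iso.completeGraph (Fintype.equivFinOfCardEq hcard)⟩ hniso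
    · push Not at hy
      obtain ⟨z, hne, hyz⟩ := hy
      rw [Set.inter_comm]
      exact hcf.ncard_commonNeighbors_le_five hdc hxy.symm hne hyz
  · push Not at hx
    obtain ⟨z, hne, hxz⟩ := hx
    exact hcf.ncard_commonNeighbors_le_five hdc hxy hne hxz
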